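/- Fix θ > 0 and define, for complex z with Re z ≥ 0 and z ≠ 0, p(z) = ψ₂(z) − (ψ₃(θ)/ψ₂(θ))·ψ₁(z) = −2·S₃(z) + 3·(S₄(θ)/S₃(θ))·S₂(z). If p(z) = p(θ), then z = θ. In other words, θ is the only critical point in the closed right half-plane of the function h(z) = (λ²/2)[(ψ₂(θ)z − ψ₁(z)) − (ψ₃(θ)/ψ₂(θ))(ψ₁(θ)z − ψ(z))]. -/

import Mathlib

open Complex

/-- `S j z = ∑_{k=0}^∞ 1/(z+k)^j`, the series defining the polygamma functions:
`ψ₁ = S₂`, `ψ₂ = −2S₃`, `ψ₃ = 6S₄`. -/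
noncomputable def S (j : ℕ) (z : ℂ) : ℂ := ∑' k : ℕ, 1 / (z + k) ^ j

open Filter Topology ComplexConjugate

section Series

lemma norm_one_div_add_nat_pow_le {δ : ℝ} (hδ : 0 < δ) {z : ℂ} (hz : δ ≤ z.re) (j k : ℕ) :
    ‖1 / (z + k) ^ j‖ ≤ 1 / (δ + k) ^ j := by
  rw [norm_div, norm_one, norm_pow]
  have h : δ + k ≤ ‖z + k‖ := by
    have := Complex.re_le_norm (z + k)
    simp only [add_re, natCast_re] at this
    linarith
  gcongr

lemma summable_one_div_add_nat_pow (x : ℝ) (hx : 0 < x) {j : ℕ} (hj : 2 ≤ j) :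
    Summable fun k : ℕ => 1 / (x + k) ^ j := by
  have h := (Real.summable_one_div_nat_add_rpow x j).2 (by exact_mod_cast hj)
  refine h.congr fun k => ?_
  rw [abs_of_pos (by positivity), Real.rpow_natCast, add_comm]

lemma summable_S_of_re_pos {z : ℂ} (hz : 0 < z.re) {j : ℕ} (hj : 2 ≤ j) :
    Summable fun k : ℕ => 1 / (z + k) ^ j :=
  .of_norm_bounded (summable_one_div_add_nat_pow z.re hz hj)
    fun k => norm_one_div_add_nat_pow_le hz le_rfl j k

lemma summable_S {z : ℂ} (hz : 0 ≤ z.re) {j : ℕ} (hj : 2 ≤ j) :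
    Summable fun k : ℕ => 1 / (z + k) ^ j := by
  rw [← summable_nat_add_iff 1]
  refine (summable_S_of_re_pos (z := z + 1) (by simp; linarith) hj).congr fun k => ?_
  push_cast
  ring_nf

lemma S_eq_add {z : ℂ} (hz : 0 ≤ z.re) {j : ℕ} (hj : 2 ≤ j) :
    S j z = 1 / z ^ j + S j (z + 1) := by
  rw [S, (summable_S hz hj).tsum_eq_zero_add, S]
  congr 1
  · simp
  · refine tsum_congr fun k => ?_
    push_cast
    ring_nf

lemma norm_S_le {δ : ℝ} (hδ : 0 < δ) {z : ℂ} (hz : δ ≤ z.re) {j : ℕ} (hj : 2 ≤ j) :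
    ‖S j z‖ ≤ ∑' k : ℕ, 1 / (δ + k) ^ j :=
  tsum_of_norm_bounded (summable_one_div_add_nat_pow δ hδ hj).hasSum
    fun k => norm_one_div_add_nat_pow_le hδ hz j k

lemma S_ofReal (j : ℕ) (x : ℝ) : S j (x : ℂ) = ((∑' k : ℕ, 1 / (x + k) ^ j : ℝ) : ℂ) := by
  simp [S, Complex.ofReal_tsum]

lemma S_conj (j : ℕ) (z : ℂ) : S j (conj z) = conj (S j z) := by
  simp [S, Complex.conj_tsum]

lemma hasDerivAt_S {z : ℂ} (hz : 0 < z.re) {j : ℕ} (hj : 2 ≤ j) :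
    HasDerivAt (S j) (-j * S (j + 1) z) z := by
  have hδ : 0 < z.re / 2 := by linarith
  have hmem : z ∈ {w : ℂ | z.re / 2 < w.re} := by simp only [Set.mem_ofPred_eq]; linarith
  have key := hasDerivAt_tsum_of_isPreconnected (𝕜 := ℂ)
    (g := fun (k : ℕ) (w : ℂ) => 1 / (w + k) ^ j)
    (g' := fun (k : ℕ) (w : ℂ) => -j * (1 / (w + k) ^ (j + 1)))
    (t := {w : ℂ | z.re / 2 < w.re})
    ((summable_one_div_add_nat_pow (z.re / 2) hδ (j := j + 1) (by omega)).mul_left (j : ℝ))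
    (isOpen_lt continuous_const Complex.continuous_re)
    (convex_halfSpace_re_gt _).isPreconnected ?_ ?_ hmem
    (summable_S_of_re_pos hz hj) hmem
  · rw [tsum_mul_left] at key
    exact key
  · intro k w hw
    have hw' : w + k ≠ 0 := by
      intro h0
      have := congrArg Complex.re h0
      simp only [Set.mem_ofPred_eq, add_re, natCast_re, zero_re] at hw this
      have : (0 : ℝ) ≤ k := k.cast_nonneg
      linarith
    have h1 := (((hasDerivAt_id w).add_const (k : ℂ)).pow j).inv (pow_ne_zero j hw')
    simp only [one_div]
    refine h1.congr_deriv ?_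
    obtain ⟨i, rfl⟩ : ∃ i, j = i + 1 := ⟨j - 1, by omega⟩
    simp only [id, add_tsub_cancel_right, Pi.pow_apply]
    field_simp
    ring
  · intro k w hw
    rw [norm_mul, norm_neg, Complex.norm_natCast]
    exact mul_le_mul_of_nonneg_left
      (norm_one_div_add_nat_pow_le hδ (le_of_lt hw) _ k) (by positivity)

end Series

section Telescoping

lemma tsum_le_of_telescope {f u : ℕ → ℝ} (hf : Summable f) (hu : ∀ k, 0 ≤ u k)
    (h : ∀ k, f k ≤ u k - u (k + 1)) : ∑' k, f k ≤ u 0 := by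
  refine hf.tsum_le_of_sum_range_le fun n => ?_
  calc ∑ i ∈ Finset.range n, f i ≤ ∑ i ∈ Finset.range n, (u i - u (i + 1)) :=
        Finset.sum_le_sum fun i _ => h i
    _ = u 0 - u n := Finset.sum_range_sub' u n
    _ ≤ u 0 := by linarith [hu n]

lemma le_tsum_of_telescope {f u : ℕ → ℝ} (hf : Summable f) (hu : Tendsto u atTop (𝓝 0))
    (h : ∀ k, u k - u (k + 1) ≤ f k) : u 0 ≤ ∑' k, f k := by
  have h1 : Tendsto (fun n => u 0 - u n) atTop (𝓝 (u 0)) := by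
    simpa using hu.const_sub (u 0)
  refine le_of_tendsto_of_tendsto' h1 hf.hasSum.tendsto_sum_nat fun n => ?_
  rw [← Finset.sum_range_sub' u n]
  exact Finset.sum_le_sum fun i _ => h i

end Telescoping

section RealAxis

/-- The weighted average of `1 / (θ + k)` with weights `1 / (θ + k) ^ 3` is at least `2 / (3 θ)`. -/
lemma two_mul_tsum_le {θ : ℝ} (hθ : 0 < θ) :
    2 * ∑' k : ℕ, 1 / (θ + k) ^ 3 ≤ 3 * θ * ∑' k : ℕ, 1 / (θ + k) ^ 4 := by
  have shift (j : ℕ) (hj : 2 ≤ j) :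
      ∑' k : ℕ, 1 / (θ + k) ^ j = 1 / θ ^ j + ∑' k : ℕ, 1 / (θ + 1 + k) ^ j := by
    rw [(summable_one_div_add_nat_pow θ hθ hj).tsum_eq_zero_add]
    congr 1
    · simp
    · refine tsum_congr fun k => ?_
      push_cast
      ring_nf
  have h3 : ∑' k : ℕ, 1 / (θ + 1 + k) ^ 3 ≤ 1 / (2 * (θ + 1 / 2) ^ 2) := by
    have := tsum_le_of_telescope (u := fun k : ℕ => 1 / (2 * (θ + 1 / 2 + k) ^ 2))
      (summable_one_div_add_nat_pow (θ + 1) (by positivity) (j := 3) (by norm_num))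
      (fun k => by positivity) (fun k => ?_)
    · simpa using this
    · have hx : 0 < θ + k := by positivity
      push_cast
      generalize hxx : θ + (k : ℝ) = x at hx
      rw [show θ + 1 + (k : ℝ) = x + 1 by linarith, show θ + 1 / 2 + (k : ℝ) = x + 1 / 2 by linarith,
        show θ + 1 / 2 + ((k : ℝ) + 1) = x + 3 / 2 by linarith, div_sub_div _ _ (by positivity)
        (by positivity), div_le_div_iff₀ (by positivity) (by positivity)]
      nlinarith [pow_pos hx 2, pow_pos hx 3]
  have h4 : 1 / (3 * (θ + 1) ^ 3) + 1 / (2 * (θ + 1) ^ 4) ≤ ∑' k : ℕ, 1 / (θ + 1 + k) ^ 4 := by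
    have := le_tsum_of_telescope
      (u := fun k : ℕ => 1 / (3 * (θ + 1 + k) ^ 3) + 1 / (2 * (θ + 1 + k) ^ 4))
      (summable_one_div_add_nat_pow (θ + 1) (by positivity) (j := 4) (by norm_num))
      ?_ (fun k => ?_)
    · simpa using this
    · have ht : Tendsto (fun k : ℕ => θ + 1 + (k : ℝ)) atTop atTop :=
        tendsto_atTop_add_const_left _ _ tendsto_natCast_atTop_atTop
      have h1 := ((tendsto_pow_atTop (n := 3) (by norm_num)).comp ht).const_mul_atTop
        (show (0 : ℝ) < 3 by norm_num)
      have h2 := ((tendsto_pow_atTop (n := 4) (by norm_num)).comp ht).const_mul_atTop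
        (show (0 : ℝ) < 2 by norm_num)
      simpa using h1.inv_tendsto_atTop.add h2.inv_tendsto_atTop
    · have hx : 0 < θ + 1 + k := by positivity
      push_cast
      generalize hxx : θ + 1 + (k : ℝ) = x at hx
      rw [show θ + 1 + ((k : ℝ) + 1) = x + 1 by linarith, ← sub_nonneg]
      have : 1 / x ^ 4 - (1 / (3 * x ^ 3) + 1 / (2 * x ^ 4) -
          (1 / (3 * (x + 1) ^ 3) + 1 / (2 * (x + 1) ^ 4))) =
          (10 * x ^ 2 + 10 * x + 3) / (6 * x ^ 4 * (x + 1) ^ 4) := by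
        field_simp
        ring
      rw [this]
      positivity
  rw [shift 3 (by norm_num), shift 4 (by norm_num)]
  have h5 : 0 ≤ 3 * θ * (1 / θ ^ 4 + (1 / (3 * (θ + 1) ^ 3) + 1 / (2 * (θ + 1) ^ 4))) -
      2 * (1 / θ ^ 3 + 1 / (2 * (θ + 1 / 2) ^ 2)) := by
    have : 3 * θ * (1 / θ ^ 4 + (1 / (3 * (θ + 1) ^ 3) + 1 / (2 * (θ + 1) ^ 4))) -
        2 * (1 / θ ^ 3 + 1 / (2 * (θ + 1 / 2) ^ 2)) =
        (2 + 16 * θ + 52 * θ ^ 2 + 80 * θ ^ 3 + 55 * θ ^ 4 + 14 * θ ^ 5 + 4 * θ ^ 6) /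
          (2 * θ ^ 3 * (θ + 1) ^ 4 * (2 * θ + 1) ^ 2) := by
      field_simp
      ring
    rw [this]
    positivity
  have h6 := mul_le_mul_of_nonneg_left h4 (show 0 ≤ 3 * θ by positivity)
  linarith

end RealAxis

section ImaginaryAxis

lemma one_div_mul_I_add_pow {y : ℝ} (hy : y ≠ 0) (k j : ℕ) :
    1 / ((y : ℂ) * I + k) ^ j = ((k : ℂ) - y * I) ^ j / (((k ^ 2 + y ^ 2) ^ j : ℝ) : ℂ) := by
  have h1 : (k : ℝ) ^ 2 + y ^ 2 ≠ 0 := by positivity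
  have h2 : ((y : ℂ) * I + k) * (k - y * I) = ((k ^ 2 + y ^ 2 : ℝ) : ℂ) := by
    push_cast
    linear_combination -(y : ℂ) ^ 2 * I_sq
  have h3 : ((y : ℂ) * I + k) * (k - y * I) ≠ 0 := by
    rw [h2]
    exact_mod_cast h1
  rw [ofReal_pow, ← h2, mul_pow, div_mul_cancel_right₀ (pow_ne_zero j (right_ne_zero_of_mul h3)),
    one_div]

lemma re_S_three_mul_I_ge {y : ℝ} (hy : y ≠ 0) :
    -(3 / 4 / y ^ 2) ≤ (S 3 (y * I)).re := by
  have hs : HasSum (fun k : ℕ => (1 / ((y : ℂ) * I + k) ^ 3).re) (S 3 (y * I)).re :=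
    Complex.hasSum_re (summable_S (by simp) (by norm_num)).hasSum
  have hy2 : 0 < y ^ 2 := by positivity
  have key (k : ℕ) : 0 ≤ (k : ℝ) * (k - 1) := by
    rcases k with _ | k
    · simp
    · push_cast
      rw [add_sub_cancel_right]
      positivity
  have := tsum_le_of_telescope
    (u := fun k : ℕ => 3 * y ^ 2 / 4 * (1 / (k * (k - 1) + y ^ 2) ^ 2))
    hs.neg.summable (fun k => by positivity) (fun k => ?_)
  · rw [hs.neg.tsum_eq] at this
    have h0 : 3 * y ^ 2 / 4 * (1 / (((0 : ℕ) : ℝ) * (((0 : ℕ) : ℝ) - 1) + y ^ 2) ^ 2) =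
        3 / 4 / y ^ 2 := by
      simp
      field_simp
    linarith
  · have hre : (1 / ((y : ℂ) * I + k) ^ 3).re = k * (k ^ 2 - 3 * y ^ 2) / (k ^ 2 + y ^ 2) ^ 3 := by
      rw [one_div_mul_I_add_pow hy, div_ofReal_re]
      congr 1
      simp [pow_succ]
      ring
    rw [hre]
    have hk := key k
    have hk0 : (0 : ℝ) ≤ k := k.cast_nonneg
    push_cast
    generalize (k : ℝ) = x at hk hk0 ⊢
    have hA : 0 < x * (x - 1) + y ^ 2 := by positivity
    have hB : 0 < (x + 1) * (x + 1 - 1) + y ^ 2 := by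
      rw [add_sub_cancel_right]
      positivity
    have hD : 0 < x ^ 2 + y ^ 2 := by positivity
    calc -(x * (x ^ 2 - 3 * y ^ 2) / (x ^ 2 + y ^ 2) ^ 3)
        ≤ 3 * y ^ 2 * x / (x ^ 2 + y ^ 2) ^ 3 := by
          rw [← neg_div]
          gcongr
          nlinarith [pow_nonneg hk0 3]
      _ = 3 * y ^ 2 / 4 * (4 * x * (x ^ 2 + y ^ 2) / ((x ^ 2 + y ^ 2) ^ 2) ^ 2) := by
          field_simp
      _ ≤ 3 * y ^ 2 / 4 * (4 * x * (x ^ 2 + y ^ 2) /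
            ((x * (x - 1) + y ^ 2) * ((x + 1) * (x + 1 - 1) + y ^ 2)) ^ 2) := by
          gcongr
          nlinarith
      _ = _ := by
          field_simp
          ring

lemma mul_im_S_two_mul_I_le {y : ℝ} (hy : y ≠ 0) :
    y * (S 2 (y * I)).im ≤ -(y ^ 2 / (y ^ 2 + 1 / 2)) := by
  have hs : HasSum (fun k : ℕ => -(y * (1 / ((y : ℂ) * I + k) ^ 2).im))
      (-(y * (S 2 (y * I)).im)) :=
    ((Complex.hasSum_im (summable_S (by simp) (by norm_num)).hasSum).mul_left y).neg
  have hy2 : 0 < y ^ 2 := by positivity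
  have key (k : ℕ) : 0 ≤ (k : ℝ) * (k - 1) := by
    rcases k with _ | k
    · simp
    · push_cast
      rw [add_sub_cancel_right]
      positivity
  have := le_tsum_of_telescope (u := fun k : ℕ => y ^ 2 / (k * (k - 1) + y ^ 2 + 1 / 2))
    hs.summable ?_ (fun k => ?_)
  · rw [hs.tsum_eq] at this
    simp only [Nat.cast_zero, zero_mul, zero_add] at this
    linarith
  · have h1 : Tendsto (fun k : ℕ => (k : ℝ) * (k - 1)) atTop atTop :=
      tendsto_natCast_atTop_atTop.atTop_mul_atTop₀
        (tendsto_atTop_add_const_right _ (-1) tendsto_natCast_atTop_atTop)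
    exact (tendsto_atTop_add_const_right _ _ (tendsto_atTop_add_const_right _ _ h1)).const_div_atTop
      (y ^ 2)
  · have him : -(y * (1 / ((y : ℂ) * I + k) ^ 2).im) = 2 * y ^ 2 * k / (k ^ 2 + y ^ 2) ^ 2 := by
      rw [one_div_mul_I_add_pow hy, div_ofReal_im, ← mul_div_assoc, ← neg_div]
      congr 1
      simp [pow_succ]
      ring
    rw [him]
    have hk := key k
    have hk0 : (0 : ℝ) ≤ k := k.cast_nonneg
    push_cast
    generalize (k : ℝ) = x at hk hk0 ⊢
    have hA : 0 < x * (x - 1) + y ^ 2 + 1 / 2 := by positivity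
    have hB : 0 < (x + 1) * (x + 1 - 1) + y ^ 2 + 1 / 2 := by
      rw [add_sub_cancel_right]
      positivity
    have hD : 0 < x ^ 2 + y ^ 2 := by positivity
    calc _ = 2 * y ^ 2 * x /
          ((x * (x - 1) + y ^ 2 + 1 / 2) * ((x + 1) * (x + 1 - 1) + y ^ 2 + 1 / 2)) := by
          rw [div_sub_div _ _ hA.ne' hB.ne']
          ring
      _ ≤ _ := by
          gcongr
          nlinarith

/-- Summing over all integers instead of the naturals, on the upper imaginary axis. -/
lemma S_add_conj_mul_I {y : ℝ} (hy : 0 < y) {j : ℕ} (hj : 1 ≤ j) :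
    ∃ R : ℝ, 0 ≤ R ∧ S (j + 1) (y * I) + (-1) ^ (j + 1) * conj (S (j + 1) (y * I))
      - 1 / (y * I : ℂ) ^ (j + 1) = ((-2 * Real.pi * I) ^ (j + 1) / (j.factorial : ℂ)) * R := by
  have hs := (summable_S (z := y * I) (by simp) (j := j + 1) (by omega)).hasSum
  have hs' : HasSum (fun k : ℕ => 1 / ((y : ℂ) * I + ((-(k : ℤ) : ℤ) : ℂ)) ^ (j + 1))
      ((-1) ^ (j + 1) * conj (S (j + 1) (y * I))) := by
    refine ((Complex.hasSum_conj'.2 hs).mul_left _).congr_fun fun k => ?_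
    rw [map_div₀, map_one, map_pow, map_add, map_mul, conj_ofReal, conj_I, conj_natCast]
    push_cast
    rw [show (y * I + -(k : ℂ)) = -1 * (y * -I + k) by ring, mul_pow, ← one_div_mul_one_div,
      ← one_div_pow, one_div_neg_one_eq_neg_one]
  have h := HasSum.of_nat_of_neg
    (f := fun n : ℤ => 1 / ((y : ℂ) * I + n) ^ (j + 1)) (by simpa using hs) hs'
  have hq := EisensteinSeries.qExpansion_identity hj ⟨y * I, by simpa using hy⟩
  refine ⟨∑' n : ℕ, (n : ℝ) ^ j * Real.exp (-2 * Real.pi * y) ^ n,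
    tsum_nonneg fun n => by positivity, ?_⟩
  have e : cexp (2 * Real.pi * I * (y * I)) = (Real.exp (-2 * Real.pi * y) : ℝ) := by
    push_cast
    congr 1
    linear_combination 2 * Real.pi * y * I_sq
  have := h.tsum_eq.symm.trans hq
  simp only [e] at this
  push_cast at this ⊢
  simpa [S] using this

lemma re_S_two_mul_I_le {y : ℝ} (hy : 0 < y) : (S 2 (y * I)).re ≤ -(1 / 2 / y ^ 2) := by
  obtain ⟨R, hR, h⟩ := S_add_conj_mul_I hy (j := 1) le_rfl
  have h1 : 1 / (y * I : ℂ) ^ (1 + 1) = ((-(1 / y ^ 2) : ℝ) : ℂ) := by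
    push_cast
    rw [mul_pow, I_sq]
    ring
  have h2 : (-2 * Real.pi * I : ℂ) ^ (1 + 1) / (Nat.factorial 1 : ℂ) * R =
      ((-(4 * Real.pi ^ 2 * R) : ℝ) : ℂ) := by
    push_cast
    rw [mul_pow, I_sq, Nat.factorial_one]
    push_cast
    ring
  rw [h1, h2] at h
  have h3 := congrArg Complex.re h
  rw [sub_re, add_re, ofReal_re, ofReal_re, neg_one_sq, one_mul, conj_re] at h3
  have h4 : 0 ≤ 4 * Real.pi ^ 2 * R := by positivity
  rw [div_div, mul_comm 2, ← div_div]
  norm_num at h3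
  rw [inv_eq_one_div] at h3
  linarith

lemma im_S_three_mul_I_ge {y : ℝ} (hy : 0 < y) : 1 / 2 / y ^ 3 ≤ (S 3 (y * I)).im := by
  obtain ⟨R, hR, h⟩ := S_add_conj_mul_I hy (j := 2) (by norm_num)
  have h1 : 1 / (y * I : ℂ) ^ (2 + 1) = ((1 / y ^ 3 : ℝ) : ℂ) * I := by
    push_cast
    rw [mul_pow, I_pow_three]
    have : (y : ℂ) ≠ 0 := by exact_mod_cast hy.ne'
    field_simp
    simp
  have h2 : (-2 * Real.pi * I : ℂ) ^ (2 + 1) / (Nat.factorial 2 : ℂ) * R =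
      ((4 * Real.pi ^ 3 * R : ℝ) : ℂ) * I := by
    push_cast
    rw [mul_pow, I_pow_three]
    simp
    ring
  rw [h1, h2] at h
  have h3 := congrArg Complex.im h
  rw [sub_im, add_im, im_ofReal_mul, im_ofReal_mul] at h3
  simp [pow_succ] at h3
  have h4 : 0 ≤ 4 * Real.pi ^ 3 * R := by positivity
  field_simp at h3 ⊢
  nlinarith [mul_nonneg h4 (pow_pos hy 3).le]

end ImaginaryAxis

section CriticalPoint

/-- The combination of real and imaginary parts of `p` on the imaginary axis which controls the
argument of `p - p(θ)` there. -/
lemma imaginary_axis_pos {θ c P : ℝ} (hθ : 0 < θ) (hc : 2 ≤ 3 * c * θ) (hP : 0 ≤ P)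
    {y : ℝ} (hy : 0 < y) :
    0 < y * (P - (-2 * S 3 (y * I) + 3 * (c : ℂ) * S 2 (y * I)).re)
      - θ * (-2 * S 3 (y * I) + 3 * (c : ℂ) * S 2 (y * I)).im := by
  have a3 := re_S_three_mul_I_ge hy.ne'
  have b2 := mul_im_S_two_mul_I_le hy.ne'
  have a2 := re_S_two_mul_I_le hy
  have b3 := im_S_three_mul_I_ge hy
  have hre : (-2 * S 3 (y * I) + 3 * (c : ℂ) * S 2 (y * I)).re =
      -2 * (S 3 (y * I)).re + 3 * c * (S 2 (y * I)).re := by simp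
  have him : (-2 * S 3 (y * I) + 3 * (c : ℂ) * S 2 (y * I)).im =
      -2 * (S 3 (y * I)).im + 3 * c * (S 2 (y * I)).im := by simp
  rw [hre, him]
  generalize (S 3 (y * I)).re = A3 at *
  generalize (S 2 (y * I)).re = A2 at *
  generalize (S 3 (y * I)).im = B3 at *
  generalize (S 2 (y * I)).im = B2 at *
  have hy2 : 0 < y ^ 2 := by positivity
  have hc0 : 0 < c := by
    by_contra! h
    nlinarith
  have e1 : -(3 / 4) ≤ y ^ 2 * A3 := by
    have := mul_le_mul_of_nonneg_left a3 hy2.le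
    field_simp at this ⊢
    linarith
  have e2 : 1 / θ ≤ 3 * c * (-(y ^ 2 * A2)) := by
    have h1 : 1 / 2 ≤ -(y ^ 2 * A2) := by
      have := mul_le_mul_of_nonneg_left a2 hy2.le
      field_simp at this ⊢
      linarith
    calc 1 / θ ≤ 3 * c * (1 / 2) := by
          rw [div_le_iff₀ hθ]
          linarith
      _ ≤ _ := by gcongr
  have e3 : θ / y ^ 2 ≤ 2 * θ * (y * B3) := by
    have h1 : 1 / 2 / y ^ 2 ≤ y * B3 := by
      have := mul_le_mul_of_nonneg_left b3 hy.le
      refine le_trans (le_of_eq ?_) this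
      field_simp
    calc θ / y ^ 2 = 2 * θ * (1 / 2 / y ^ 2) := by ring
      _ ≤ _ := by gcongr
  have e4 : 2 * (y ^ 2 / (y ^ 2 + 1 / 2)) ≤ 3 * c * θ * -(y * B2) := by
    have : 0 ≤ y ^ 2 / (y ^ 2 + 1 / 2) := by positivity
    exact mul_le_mul hc (by linarith) this (by positivity)
  have e5 : 2 / y ≤ 1 / θ + θ / y ^ 2 := by
    rw [div_add_div _ _ (by positivity) (by positivity), div_le_div_iff₀ (by positivity)
      (by positivity)]
    nlinarith [mul_nonneg hy.le (sq_nonneg (y - θ))]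
  have e6 : 2 - 2 / y ≤ 2 * (y ^ 2 / (y ^ 2 + 1 / 2)) := by
    have h1 : 2 * (y ^ 2 / (y ^ 2 + 1 / 2)) = 2 - 2 / (2 * y ^ 2 + 1) := by
      field_simp
      ring
    have h2 : 2 / (2 * y ^ 2 + 1) ≤ 2 / y := by
      gcongr
      nlinarith [sq_nonneg (y - 1)]
    linarith
  have e7 : 0 ≤ y ^ 2 * P := by positivity
  refine pos_of_mul_pos_right (a := y) ?_ hy.le
  nlinarith

lemma re_quotient_imaginary_axis_pos {θ c P : ℝ} (hθ : 0 < θ) (hc : 2 ≤ 3 * c * θ) (hP : 0 ≤ P)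
    {y : ℝ} (hy : y ≠ 0) :
    0 < ((y * I : ℂ) ^ 3 * (P - (-2 * S 3 (y * I) + 3 * (c : ℂ) * S 2 (y * I))) /
      ((y * I - θ) ^ 2 * (y * I + θ))).re := by
  wlog hy0 : 0 < y generalizing y
  · have h := this (neg_ne_zero.2 hy) (by
      rcases lt_or_gt_of_ne hy with h | h
      · linarith
      · exact absurd h hy0)
    rw [← conj_re]
    have e : conj ((y : ℂ) * I) = ((-y : ℝ) : ℂ) * I := by simp
    simpa only [map_div₀, map_mul, map_pow, map_sub, map_add, ← S_conj, e, conj_ofReal, map_neg,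
      map_ofNat] using h
  have h := imaginary_axis_pos hθ hc hP hy0
  generalize -2 * S 3 (y * I) + 3 * (c : ℂ) * S 2 (y * I) = p at h ⊢
  have h1 : (y : ℂ) * I - θ ≠ 0 := fun h => hy (by simpa using congrArg Complex.im h)
  have h2 : (y : ℂ) * I + θ ≠ 0 := fun h => hy (by simpa using congrArg Complex.im h)
  have h3 : ((y : ℂ) ^ 2 + θ ^ 2) ≠ 0 := by
    have : y ^ 2 + θ ^ 2 ≠ 0 := by positivity
    exact_mod_cast this
  have e : (y * I : ℂ) ^ 3 * (P - p) / ((y * I - θ) ^ 2 * (y * I + θ)) =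
      ((y ^ 3 / (y ^ 2 + θ ^ 2) ^ 2 : ℝ) : ℂ) * ((P - p) * (y - θ * I)) := by
    push_cast
    rw [div_eq_iff (by positivity), div_mul_eq_mul_div, div_mul_eq_mul_div,
      eq_div_iff (by positivity)]
    have : (y : ℂ) ^ 2 + θ ^ 2 = -((y * I - θ) * (y * I + θ)) := by
      linear_combination (y : ℂ) ^ 2 * I_sq
    have h4 : (y : ℂ) - θ * I = -I * (y * I + θ) := by
      linear_combination (y : ℂ) * I_sq
    have h5 : (y * I : ℂ) ^ 3 = - I * y ^ 3 := by
      rw [mul_pow, I_pow_three]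
      ring
    rw [this, h4, h5]
    ring
  rw [e, re_ofReal_mul]
  have : ((P - p) * ((y : ℂ) - θ * I)).re = y * (P - p.re) - θ * p.im := by
    simp
    ring
  rw [this]
  positivity

lemma exists_differentiableOn_quotient {θ c P : ℝ} (hθ : 0 < θ)
    (hP : (P : ℂ) = -2 * S 3 (θ : ℂ) + 3 * (c : ℂ) * S 2 (θ : ℂ))
    (hcrit : S 4 (θ : ℂ) = c * S 3 (θ : ℂ)) :
    ∃ F : ℂ → ℂ, DifferentiableOn ℂ F {z | 0 ≤ z.re} ∧ F 0 = ((2 / θ ^ 3 : ℝ) : ℂ) ∧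
      ∀ z : ℂ, 0 ≤ z.re → z ≠ 0 → z ≠ θ → F z =
        z ^ 3 * (P - (-2 * S 3 z + 3 * (c : ℂ) * S 2 z)) / ((z - θ) ^ 2 * (z + θ)) := by
  let G : ℂ → ℂ := fun z =>
    z ^ 3 * P + 2 - 3 * c * z - z ^ 3 * (-2 * S 3 (z + 1) + 3 * c * S 2 (z + 1))
  have hG (z : ℂ) (hz : 0 ≤ z.re) (hz0 : z ≠ 0) :
      G z = z ^ 3 * (P - (-2 * S 3 z + 3 * (c : ℂ) * S 2 z)) := by
    rw [S_eq_add hz (j := 3) (by norm_num), S_eq_add hz (j := 2) (by norm_num)]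
    simp only [G]
    field_simp
    ring
  have hSd (j : ℕ) (hj : 2 ≤ j) {z : ℂ} (hz : -1 < z.re) :
      DifferentiableAt ℂ (fun z => S j (z + 1)) z :=
    ((hasDerivAt_S (z := z + 1) (by simp; linarith) hj).comp_add_const z 1).differentiableAt
  have hGd : DifferentiableOn ℂ G {z | -1 < z.re} := fun z hz => by
    have h3 := hSd 3 (by norm_num) hz
    have h2 := hSd 2 (by norm_num) hz
    refine DifferentiableAt.differentiableWithinAt ?_
    fun_prop
  have hθ0 : (θ : ℂ) ≠ 0 := by exact_mod_cast hθ.ne'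
  have hGθ : G θ = 0 := by
    rw [hG θ (by simpa using hθ.le) hθ0, hP]
    ring
  have hGθ' : deriv G θ = 0 := by
    have hre : 0 < (θ : ℂ).re := by simpa using hθ
    have e : G =ᶠ[𝓝 (θ : ℂ)] fun z => z ^ 3 * (P - (-2 * S 3 z + 3 * (c : ℂ) * S 2 z)) := by
      filter_upwards [(isOpen_lt continuous_const Complex.continuous_re).mem_nhds hre] with z hz
      refine hG z (le_of_lt hz) ?_
      rintro rfl
      simp at hz
    rw [e.deriv_eq]
    have h3 := hasDerivAt_S hre (j := 3) (by norm_num)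
    have h2 := hasDerivAt_S hre (j := 2) (by norm_num)
    have := (hasDerivAt_pow 3 (θ : ℂ)).mul
      (((h3.const_mul (-2)).add (h2.const_mul (3 * (c : ℂ)))).const_sub (P : ℂ))
    refine this.deriv.trans ?_
    simp only [Pi.add_apply]
    rw [← hP]
    push_cast
    linear_combination (-6 * (θ : ℂ) ^ 3) * hcrit
  have hU : {z : ℂ | -1 < z.re} ∈ 𝓝 (θ : ℂ) :=
    (isOpen_lt continuous_const Complex.continuous_re).mem_nhds (by
      simp only [Set.mem_ofPred_eq, ofReal_re]
      linarith)
  have hHd : DifferentiableOn ℂ (dslope (dslope G θ) θ) {z | -1 < z.re} :=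
    (Complex.differentiableOn_dslope hU).2 ((Complex.differentiableOn_dslope hU).2 hGd)
  have hH (z : ℂ) (hz : z ≠ θ) : dslope (dslope G θ) θ z = G z / (z - θ) ^ 2 := by
    have : z - θ ≠ 0 := sub_ne_zero.2 hz
    rw [dslope_of_ne _ hz, slope_def_field, dslope_of_ne _ hz, dslope_same, slope_def_field, hGθ,
      hGθ']
    field_simp
    ring
  refine ⟨fun z => dslope (dslope G θ) θ z / (z + θ), ?_, ?_, fun z hz hz0 hzθ => ?_⟩
  · refine (hHd.mono fun z (hz : 0 ≤ z.re) => ?_).div (by fun_prop) fun z hz h0 => ?_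
    · simp only [Set.mem_ofPred_eq]
      linarith
    · have hz' : 0 ≤ z.re := hz
      have := congrArg Complex.re h0
      simp only [add_re, ofReal_re, zero_re] at this
      linarith
  · simp only
    rw [hH 0 hθ0.symm]
    simp [G]
    field_simp
  · simp only
    rw [hH z hzθ, hG z hz hz0, div_div]

lemma eventually_norm_quotient_le {θ : ℝ} (hθ : 0 < θ) (c P : ℝ) :
    ∃ M R : ℝ, θ < R ∧ ∀ z : ℂ, 0 ≤ z.re → R ≤ ‖z‖ →
      ‖z ^ 3 * (P - (-2 * S 3 z + 3 * (c : ℂ) * S 2 z)) / ((z - θ) ^ 2 * (z + θ))‖ ≤ M := by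
  have hS (j : ℕ) (hj : 2 ≤ j) (z : ℂ) (hz : 0 ≤ z.re) (hz1 : 1 ≤ ‖z‖) :
      ‖S j z‖ ≤ 1 + ∑' k : ℕ, 1 / ((1 : ℝ) + k) ^ j := by
    rw [S_eq_add hz hj]
    refine (norm_add_le _ _).trans (add_le_add ?_ (norm_S_le one_pos (by simpa using hz) hj))
    rw [norm_div, norm_one, norm_pow]
    exact div_le_one_of_le₀ (one_le_pow₀ hz1) (by positivity)
  set C3 := 1 + ∑' k : ℕ, 1 / ((1 : ℝ) + k) ^ 3
  set C2 := 1 + ∑' k : ℕ, 1 / ((1 : ℝ) + k) ^ 2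
  refine ⟨4 * (|P| + (2 * C3 + 3 * |c| * C2)), max 1 (2 * θ), ?_, fun z hz hR => ?_⟩
  · exact lt_max_of_lt_right (by linarith)
  have hz1 : 1 ≤ ‖z‖ := (le_max_left _ _).trans hR
  have hz2 : 2 * θ ≤ ‖z‖ := (le_max_right _ _).trans hR
  have h1 : ‖z‖ / 2 ≤ ‖z - θ‖ := by
    have := norm_sub_norm_le z θ
    rw [Complex.norm_of_nonneg hθ.le] at this
    linarith
  have h2 : ‖z‖ ≤ ‖z + θ‖ := by
    rw [Complex.norm_eq_sqrt_sq_add_sq, Complex.norm_eq_sqrt_sq_add_sq]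
    simp only [add_re, ofReal_re, add_im, ofReal_im, add_zero]
    gcongr
    linarith
  have hp : ‖(P : ℂ) - (-2 * S 3 z + 3 * (c : ℂ) * S 2 z)‖ ≤ |P| + (2 * C3 + 3 * |c| * C2) := by
    refine (norm_sub_le _ _).trans (add_le_add (by simp) ((norm_add_le _ _).trans ?_))
    simp only [norm_mul, norm_neg, Complex.norm_ofNat, Complex.norm_real, Real.norm_eq_abs]
    gcongr
    · exact hS 3 (by norm_num) z hz hz1
    · exact hS 2 (by norm_num) z hz hz1
  have hpos : 0 < ‖z‖ := by linarith
  have hpos' : 0 < ‖z - θ‖ := by linarith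
  have hpos'' : 0 < ‖z + θ‖ := by linarith
  rw [norm_div, norm_mul, norm_mul, norm_pow, norm_pow, div_le_iff₀ (by positivity)]
  calc ‖z‖ ^ 3 * ‖(P : ℂ) - (-2 * S 3 z + 3 * (c : ℂ) * S 2 z)‖
      ≤ ‖z‖ ^ 3 * (|P| + (2 * C3 + 3 * |c| * C2)) := by gcongr
    _ = 4 * (|P| + (2 * C3 + 3 * |c| * C2)) * ((‖z‖ / 2) ^ 2 * ‖z‖) := by ring
    _ ≤ _ := by
      have := (norm_nonneg _).trans hp
      gcongr

/-- A holomorphic function on the right half-plane, bounded near infinity, whose real part is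
positive on the imaginary axis, has positive real part everywhere. -/
lemma re_pos_of_re_pos_imaginary_axis {F : ℂ → ℂ} (hF : DifferentiableOn ℂ F {z | 0 ≤ z.re})
    {M R : ℝ} (hM : ∀ z : ℂ, 0 ≤ z.re → R ≤ ‖z‖ → ‖F z‖ ≤ M)
    (hpos : ∀ y : ℝ, 0 < (F (y * I)).re) {z : ℂ} (hz : 0 ≤ z.re) : 0 < (F z).re := by
  have hcl : closure {z : ℂ | 0 < z.re} = {z | 0 ≤ z.re} := Complex.closure_setOfPred_lt_re 0
  have hd : DiffContOnCl ℂ (fun z => cexp (-F z)) {z | 0 < z.re} := by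
    apply DifferentiableOn.diffContOnCl
    rw [hcl]
    exact hF.neg.cexp
  have hnorm (w : ℂ) : ‖cexp (-F w)‖ = Real.exp (-(F w).re) := by rw [norm_exp, neg_re]
  have hbd (w : ℂ) (hw : 0 ≤ w.re) (hR : R ≤ ‖w‖) : ‖cexp (-F w)‖ ≤ Real.exp M := by
    rw [hnorm]
    have := abs_le.1 ((Complex.abs_re_le_norm (F w)).trans (hM w hw hR))
    exact Real.exp_le_exp.2 (by linarith)
  have hle (w : ℂ) (hw : 0 ≤ w.re) : ‖cexp (-F w)‖ ≤ 1 := by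
    refine PhragmenLindelof.right_half_plane_of_bounded_on_real
      (f := fun z => cexp (-F z)) hd ⟨0, by norm_num, M, ?_⟩ ?_
      (fun y => ?_) hw
    · refine Asymptotics.IsBigO.of_bound 1 ?_
      rw [eventually_inf_principal]
      filter_upwards [tendsto_norm_cobounded_atTop.eventually_ge_atTop R] with w hR hw
      simpa using hbd w (le_of_lt hw) hR
    · refine ⟨Real.exp M, ?_⟩
      rw [eventually_map]
      filter_upwards [eventually_ge_atTop (max 0 R)] with x hx
      have hx0 : 0 ≤ x := (le_max_left _ _).trans hx
      refine hbd x (by simpa using hx0) ?_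
      rw [Complex.norm_of_nonneg hx0]
      exact (le_max_right _ _).trans hx
    · rw [hnorm]
      exact Real.exp_le_one_iff.2 (by linarith [hpos y])
  rcases hz.eq_or_lt with h0 | h0
  · have : z = z.im * I := Complex.ext (by simp [← h0]) (by simp)
    rw [this]
    exact hpos _
  by_contra! hneg
  have hz1 : ‖cexp (-F z)‖ = 1 := by
    refine le_antisymm (hle z hz) ?_
    rw [hnorm]
    exact Real.one_le_exp (by linarith)
  have hconst := Complex.norm_eqOn_closure_of_isPreconnected_of_isMaxOn
    (convex_halfSpace_re_gt 0).isPreconnected (isOpen_lt continuous_const Complex.continuous_re)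
    hd h0 (fun w hw => by simpa [hz1] using hle w (le_of_lt hw))
  have := hconst (x := 0) (by rw [hcl]; simp)
  simp only [Function.comp_apply, Function.const_apply, hz1] at this
  rw [hnorm, Real.exp_eq_one_iff] at this
  have h2 := hpos 0
  simp only [ofReal_zero, zero_mul] at h2
  linarith

end CriticalPoint

/-- Fix `θ > 0` and let `p(z) = ψ₂(z) − (ψ₃(θ)/ψ₂(θ))·ψ₁(z) = −2S₃(z) + 3(S₄(θ)/S₃(θ))S₂(z)`
for `z` in the closed right half plane, `z ≠ 0`.  If `p(z) = p(θ)` then `z = θ`: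
`θ` is the only critical point of `h` in the closed right half-plane. -/
theorem unique_critical_point (θ : ℝ) (hθ : 0 < θ) (z : ℂ) (hre : 0 ≤ z.re) (hz : z ≠ 0)
    (h : -2 * S 3 z + 3 * (S 4 (θ : ℂ) / S 3 (θ : ℂ)) * S 2 z
        = -2 * S 3 (θ : ℂ) + 3 * (S 4 (θ : ℂ) / S 3 (θ : ℂ)) * S 2 (θ : ℂ)) :
    z = (θ : ℂ) := by
  by_contra hne
  have hsum (j : ℕ) (hj : 2 ≤ j) := summable_one_div_add_nat_pow θ hθ hj
  have h34 := two_mul_tsum_le hθ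
  have h23 : θ * ∑' k : ℕ, 1 / (θ + k) ^ 3 ≤ ∑' k : ℕ, 1 / (θ + k) ^ 2 := by
    rw [← tsum_mul_left]
    refine ((hsum 3 (by norm_num)).mul_left θ).tsum_le_tsum (fun k => ?_) (hsum 2 le_rfl)
    rw [mul_one_div, div_le_div_iff₀ (by positivity) (by positivity)]
    nlinarith [mul_nonneg (k.cast_nonneg : (0 : ℝ) ≤ k) (sq_nonneg (θ + k))]
  have h3pos : 0 < ∑' k : ℕ, 1 / (θ + k) ^ 3 :=
    (hsum 3 (by norm_num)).tsum_pos (fun k => by positivity) 0 (by positivity)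
  obtain ⟨s2, hs2⟩ : ∃ s, s = ∑' k : ℕ, 1 / (θ + k) ^ 2 := ⟨_, rfl⟩
  obtain ⟨s3, hs3⟩ : ∃ s, s = ∑' k : ℕ, 1 / (θ + k) ^ 3 := ⟨_, rfl⟩
  obtain ⟨s4, hs4⟩ : ∃ s, s = ∑' k : ℕ, 1 / (θ + k) ^ 4 := ⟨_, rfl⟩
  have hS2 := S_ofReal 2 θ
  have hS3 := S_ofReal 3 θ
  have hS4 := S_ofReal 4 θ
  rw [← hs3, ← hs4] at h34
  rw [← hs2, ← hs3] at h23
  rw [← hs3] at h3pos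
  rw [← hs2] at hS2
  rw [← hs3] at hS3
  rw [← hs4] at hS4
  have hc : 2 ≤ 3 * (s4 / s3) * θ := by
    rw [mul_assoc, div_mul_eq_mul_div, mul_div_assoc', le_div_iff₀ h3pos]
    linarith
  have hP : 0 ≤ -2 * s3 + 3 * (s4 / s3) * s2 := by
    have hc0 : 0 ≤ 3 * (s4 / s3) := by
      by_contra! hneg
      nlinarith
    nlinarith [mul_le_mul_of_nonneg_left h23 hc0]
  have hPc : ((-2 * s3 + 3 * (s4 / s3) * s2 : ℝ) : ℂ) =
      -2 * S 3 (θ : ℂ) + 3 * ((s4 / s3 : ℝ) : ℂ) * S 2 (θ : ℂ) := by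
    rw [hS2, hS3]
    push_cast
    ring
  have hcrit : S 4 (θ : ℂ) = ((s4 / s3 : ℝ) : ℂ) * S 3 (θ : ℂ) := by
    rw [hS3, hS4, ← ofReal_mul, div_mul_cancel₀ _ h3pos.ne']
  have hq : S 4 (θ : ℂ) / S 3 (θ : ℂ) = ((s4 / s3 : ℝ) : ℂ) := by
    rw [hS3, hS4, ofReal_div]
  rw [hq, ← hPc] at h
  obtain ⟨F, hFd, hF0, hF⟩ := exists_differentiableOn_quotient hθ hPc hcrit
  obtain ⟨M, R, hR, hM⟩ := eventually_norm_quotient_le hθ (s4 / s3) (-2 * s3 + 3 * (s4 / s3) * s2)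
  have hpos : 0 < (F z).re := by
    refine re_pos_of_re_pos_imaginary_axis hFd (M := M) (R := R) (fun w hw hwR => ?_)
      (fun y => ?_) hre
    · rw [hF w hw]
      · exact hM w hw hwR
      · rintro rfl
        rw [norm_zero] at hwR
        linarith
      · rintro rfl
        rw [Complex.norm_of_nonneg hθ.le] at hwR
        linarith
    · rcases eq_or_ne y 0 with rfl | hy
      · rw [ofReal_zero, zero_mul, hF0, ofReal_re]
        positivity
      · rw [hF (y * I) (by simp) (by simpa using hy)
          (fun h0 => hy (by simpa using congrArg Complex.im h0))]
        exact re_quotient_imaginary_axis_pos hθ hc hP hy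
  rw [hF z hre hz hne, h, sub_self, mul_zero, zero_div, zero_re] at hpos
  exact lt_irrefl _ hpos
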